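/- arXiv:2105.01002 — 7 statements merged into one kernel-verified Lean document; each statement's English description precedes it below -/
import Mathlib

section
/- Let α, L, τ > 0, let μ ∈ (0,1], q ∈ (0,1], let M, m be positive integers and n a nonnegative integer. Then the time-multiplexed repeater rate satisfies the subexponential upper bound R_{m,n}(L) = (1 − (1 − μ e^{−αL/(n+1)})^{Mm})^{n+1} q^n / (mτ) ≤ (Mμ/(qτ)) · exp(−2·√(ln(1/q)·αL)). In particular the optimized rate R(L) = sup_{m,n} R_{m,n}(L) is at most (Mμ/(qτ)) e^{−2√(ln(1/q))·√(αL)}. -/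
/-- The AM-GM bound `exp (-x / k) * y ^ k ≤ exp (-2 √(log (1 / y) * x))`. -/
theorem exp_neg_div_mul_pow_le (x y : ℝ) (hx : 0 ≤ x) (hy0 : 0 < y) (hy1 : y ≤ 1) (n : ℕ) :
    Real.exp (-x / (n + 1)) * y ^ (n + 1)
      ≤ Real.exp (-2 * Real.sqrt (Real.log (1 / y) * x)) := by
  have hk : (0 : ℝ) < n + 1 := by positivity
  have hlog : 0 ≤ Real.log (1 / y) := Real.log_nonneg (by rw [le_div_iff₀ hy0]; linarith)
  have hpow : y ^ (n + 1) = Real.exp (-((n + 1) * Real.log (1 / y))) := by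
    rw [one_div, Real.log_inv, mul_neg, neg_neg, ← Nat.cast_add_one, Real.exp_nat_mul,
      Real.exp_log hy0]
  rw [hpow, ← Real.exp_add, Real.exp_le_exp]
  set c := Real.log (1 / y)
  have hu : 0 ≤ x / (n + 1) := by positivity
  have hv : 0 ≤ (n + 1) * c := by positivity
  have hprod : c * x = x / (n + 1) * ((n + 1) * c) := by field_simp
  rw [hprod, Real.sqrt_mul hu, neg_div]
  nlinarith [sq_nonneg (√(x / (n + 1)) - √((n + 1) * c)), Real.sq_sqrt hu, Real.sq_sqrt hv]

/-- The probability of at least one success among `k` trials, raised to a positive power, is at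
most the union bound `k * p`. -/
theorem one_sub_one_sub_pow_pow_le (p : ℝ) (hp0 : 0 ≤ p) (hp1 : p ≤ 1) (k n : ℕ) :
    (1 - (1 - p) ^ k) ^ (n + 1) ≤ k * p := by
  have h0 : 0 ≤ 1 - (1 - p) ^ k := sub_nonneg.2 (pow_le_one₀ (by linarith) (by linarith))
  have h1 : 1 - (1 - p) ^ k ≤ 1 := sub_le_self _ (pow_nonneg (by linarith) _)
  have h2 := one_add_mul_le_pow (a := -p) (by linarith) k
  rw [← sub_eq_add_neg] at h2
  exact (pow_le_of_le_one h0 h1 n.succ_ne_zero).trans (by linarith)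

/-- subexponential upper bound on the time-multiplexed repeater rate
`R_{m,n}(L) = (1 − (1 − μ e^{−αL/(n+1)})^{Mm})^{n+1} q^n / (mτ)`, and the consequent
bound on the optimized rate `R(L) = sup_{m,n} R_{m,n}(L)`. -/
theorem stmt0 (α L τ μ q : ℝ) (hα : 0 < α) (hL : 0 < L) (hτ : 0 < τ)
    (hμ : μ ∈ Set.Ioc (0:ℝ) 1) (hq : q ∈ Set.Ioc (0:ℝ) 1) (M : ℕ+) :
    (∀ (m : ℕ+) (n : ℕ),
      (1 - (1 - μ * Real.exp (-(α * L) / (n + 1))) ^ ((M : ℕ) * (m : ℕ))) ^ (n + 1)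
          * q ^ n / ((m : ℝ) * τ)
        ≤ ((M : ℝ) * μ / (q * τ)) * Real.exp (-2 * Real.sqrt (Real.log (1 / q) * (α * L)))) ∧
    (⨆ (m : ℕ+) (n : ℕ),
      (1 - (1 - μ * Real.exp (-(α * L) / (n + 1))) ^ ((M : ℕ) * (m : ℕ))) ^ (n + 1)
          * q ^ n / ((m : ℝ) * τ))
        ≤ ((M : ℝ) * μ / (q * τ)) * Real.exp (-2 * Real.sqrt (Real.log (1 / q) * (α * L))) := by
  have bound : ∀ (m : ℕ+) (n : ℕ),
      (1 - (1 - μ * Real.exp (-(α * L) / (n + 1))) ^ ((M : ℕ) * (m : ℕ))) ^ (n + 1)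
          * q ^ n / ((m : ℝ) * τ)
        ≤ ((M : ℝ) * μ / (q * τ)) *
          Real.exp (-2 * Real.sqrt (Real.log (1 / q) * (α * L))) := by
    intro m n
    obtain ⟨hμ0, hμ1⟩ := hμ
    obtain ⟨hq0, hq1⟩ := hq
    have hx : 0 ≤ α * L := by positivity
    have hm : (0 : ℝ) < m := by exact_mod_cast m.pos
    have he : Real.exp (-(α * L) / (n + 1)) ≤ 1 :=
      Real.exp_le_one_iff.2 (div_nonpos_of_nonpos_of_nonneg (by linarith) (by positivity))
    have hunion := one_sub_one_sub_pow_pow_le (μ * Real.exp (-(α * L) / (n + 1))) (by positivity)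
      (mul_le_one₀ hμ1 (Real.exp_pos _).le he) ((M : ℕ) * (m : ℕ)) n
    push_cast at hunion
    calc _ ≤ (M : ℝ) * m * (μ * Real.exp (-(α * L) / (n + 1))) * q ^ n / (m * τ) := by gcongr
      _ = (M : ℝ) * μ / (q * τ) * (Real.exp (-(α * L) / (n + 1)) * q ^ (n + 1)) := by
        rw [pow_succ]
        field_simp
      _ ≤ _ := by
        gcongr
        exact exp_neg_div_mul_pow_le _ _ hx hq0 hq1 n
  exact ⟨bound, ciSup_le fun m => ciSup_le (bound m)⟩
end

section
/- Let α, L, τ > 0, μ ∈ (0,1], q ∈ (0,1], and let M ≥ 1 be an integer. Set s = ln(1/(q(1−1/e))) > 0, and define the real parameters n* = √(αL/s) − 1 and m* = e^{αL/(n*+1)}/(Mμ) = e^{√(αL·s)}/(Mμ). Assume αL ≥ s (so that n* ≥ 0) and e^{√(αL·s)} ≥ Mμ (so that m* ≥ 1). Then the rate expression with these real parameters satisfies the subexponential lower bound (1 − (1 − μ e^{−αL/(n*+1)})^{M·m*})^{n*+1} q^{n*} / (m*·τ) ≥ (Mμ/(qτ)) · exp(−2·√(ln(1/(q(1−1/e)))·αL)).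 -/
theorem one_sub_rpow_inv_le_exp_neg_one {p : ℝ} (hp : 0 < p) (hp1 : p ≤ 1) :
    (1 - p) ^ p⁻¹ ≤ 1 / Real.exp 1 := by
  have h : (1 - p) ^ p⁻¹ ≤ Real.exp (-p) ^ p⁻¹ :=
    Real.rpow_le_rpow (by linarith) (Real.one_sub_le_exp_neg p) (by positivity)
  have h' : -p * p⁻¹ = -1 := by field_simp
  rwa [← Real.exp_mul, h', Real.exp_neg, inv_eq_one_div (Real.exp 1)] at h

/-- with the (real-valued) optimal choices `n* = √(αL/s) − 1` and
`m* = e^{αL/(n*+1)}/(Mμ)`, where `s = ln(1/(q(1−1/e)))`, the rate expression is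
lower-bounded by the subexponential envelope `(Mμ/(qτ)) e^{−2√(ln(1/(q(1−1/e)))·αL)}`. -/
theorem stmt1 (α L τ μ q : ℝ) (hα : 0 < α) (hL : 0 < L) (hτ : 0 < τ)
    (hμ : μ ∈ Set.Ioc (0:ℝ) 1) (hq : q ∈ Set.Ioc (0:ℝ) 1) (M : ℕ) (hM : 1 ≤ M)
    (s nstar mstar : ℝ)
    (hs : s = Real.log (1 / (q * (1 - 1 / Real.exp 1))))
    (hn : nstar = Real.sqrt (α * L / s) - 1)
    (hm : mstar = Real.exp (α * L / (nstar + 1)) / ((M : ℝ) * μ))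
    (h1 : s ≤ α * L)
    (h2 : (M : ℝ) * μ ≤ Real.exp (Real.sqrt (α * L * s))) :
    ((M : ℝ) * μ / (q * τ)) *
        Real.exp (-2 * Real.sqrt (Real.log (1 / (q * (1 - 1 / Real.exp 1))) * (α * L)))
      ≤ (1 - (1 - μ * Real.exp (-(α * L) / (nstar + 1))) ^ ((M : ℝ) * mstar)) ^ (nstar + 1)
          * q ^ nstar / (mstar * τ) := by
  obtain ⟨hμ0, hμ1⟩ := hμ
  obtain ⟨hq0, hq1⟩ := hq
  have hM0 : (0 : ℝ) < M := by exact_mod_cast hM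
  have hA : 0 < α * L := mul_pos hα hL
  rw [← hs]
  set c : ℝ := 1 - 1 / Real.exp 1 with hc
  have hc0 : 0 < c := sub_pos.2 <| by
    rw [div_lt_one (Real.exp_pos 1)]
    exact Real.one_lt_exp_iff.2 one_pos
  have hc1 : c < 1 := sub_lt_self _ (by positivity)
  have hqc : 0 < q * c := mul_pos hq0 hc0
  have hs0 : 0 < s := by
    rw [hs]
    apply Real.log_pos
    rw [one_lt_div hqc]
    nlinarith
  have hexp : Real.exp (-s) = q * c := by
    rw [hs, one_div, Real.log_inv, neg_neg, Real.exp_log hqc]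
  set t : ℝ := Real.sqrt (α * L / s) with ht
  have ht0 : 0 < t := Real.sqrt_pos.2 (div_pos hA hs0)
  have htt : α * L = s * t * t := by
    have h : t * t = α * L / s := Real.mul_self_sqrt (div_pos hA hs0).le
    rw [mul_assoc, h]
    field_simp
  have hn1 : nstar + 1 = t := by rw [hn]; ring
  have hdiv : α * L / t = s * t := by
    rw [htt]
    field_simp
  have hsqrt : Real.sqrt (s * (α * L)) = s * t := by
    rw [htt, show s * (s * t * t) = (s * t) * (s * t) by ring,
      Real.sqrt_mul_self (by positivity)]
  rw [hn1, hdiv] at hm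
  rw [hn1, hn, hsqrt, neg_div, hdiv]
  set p : ℝ := μ * Real.exp (-(s * t)) with hp
  have hp0 : 0 < p := by positivity
  have hp1 : p ≤ 1 :=
    mul_le_one₀ hμ1 (Real.exp_pos _).le
      (Real.exp_le_one_iff.2 (neg_nonpos.2 (by positivity)))
  have hMm : (M : ℝ) * mstar = p⁻¹ := by
    rw [hm, hp, Real.exp_neg]
    field_simp
  have hm0 : 0 < mstar := by rw [hm]; positivity
  rw [hMm]
  have hbase : c ≤ 1 - (1 - p) ^ p⁻¹ := by
    have := one_sub_rpow_inv_le_exp_neg_one hp0 hp1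
    linarith
  calc (M : ℝ) * μ / (q * τ) * Real.exp (-2 * (s * t))
      = c ^ t * q ^ (t - 1) / (mstar * τ) := by
        have hpow : c ^ t * q ^ (t - 1) = Real.exp (-(s * t)) / q := by
          rw [Real.rpow_sub_one hq0.ne', ← mul_div_assoc, ← Real.mul_rpow hc0.le hq0.le,
            mul_comm c q, ← hexp, ← Real.exp_mul, neg_mul]
        rw [hpow, hm, show -2 * (s * t) = -(s * t) + -(s * t) by ring, Real.exp_add,
          Real.exp_neg]
        field_simp
    _ ≤ (1 - (1 - p) ^ p⁻¹) ^ t * q ^ (t - 1) / (mstar * τ) := by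
        gcongr
end

section
/- Let τ > 0, q ∈ (0,1], and let M, μ, m > 0 and n ≥ 0 be real numbers with Mmμ > 1. Set x = (Mmμ)^{−(n+1)} ∈ (0,1). Then the ordinate of the intersection point A(m,n) satisfies q^n/(mτ) ≤ (Mμ/(qτ)) · exp(−2·√(ln(1/q)·ln(1/x))), with equality when (n+1)² = ln(1/x)/ln(1/q) (for q < 1). -/
/-- The AM-GM inequality for two nonnegative reals. -/
lemma two_mul_sqrt_mul_le_add {u v : ℝ} (hu : 0 ≤ u) (hv : 0 ≤ v) :
    2 * Real.sqrt (u * v) ≤ u + v := by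
  rw [Real.sqrt_mul hu]
  nlinarith [sq_nonneg (Real.sqrt u - Real.sqrt v), Real.sq_sqrt hu, Real.sq_sqrt hv]

/-- The ordinate `q ^ n / (m * τ)` as a multiple of an exponential whose exponent is linear in
the logarithms of `1 / q` and `M * m * μ`. -/
lemma rpow_div_eq_mul_exp {τ q M μ m : ℝ} (n : ℝ) (hτ : 0 < τ) (hq : 0 < q)
    (hM : 0 < M) (hμ : 0 < μ) (hm : 0 < m) :
    q ^ n / (m * τ) = (M * μ / (q * τ)) *
      Real.exp (-((n + 1) * Real.log (1 / q) + Real.log (M * m * μ))) := by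
  have hexp : Real.exp (-((n + 1) * Real.log (1 / q) + Real.log (M * m * μ)))
      = q ^ n * q / (M * m * μ) := by
    rw [one_div, Real.log_inv, show -((n + 1) * -Real.log q + Real.log (M * m * μ))
      = Real.log q * n + Real.log q - Real.log (M * m * μ) by ring, Real.exp_sub, Real.exp_add,
      ← Real.rpow_def_of_pos hq, Real.exp_log hq, Real.exp_log (by positivity)]
  rw [hexp]
  field_simp

/-- the ordinate of the intersection-point family `A(m,n)` at
`x = (Mmμ)^{−(n+1)}` lies below the envelope curve
`y = (Mμ/(qτ)) exp(−2√(ln(1/q)·ln(1/x)))`, with equality when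
`(n+1)² = ln(1/x)/ln(1/q)` (for `q < 1`). -/
theorem stmt6 (τ q M μ m n : ℝ) (hτ : 0 < τ) (hq : q ∈ Set.Ioc (0:ℝ) 1)
    (hM : 0 < M) (hμ : 0 < μ) (hm : 0 < m) (hn : 0 ≤ n) (hMmμ : 1 < M * m * μ)
    (x : ℝ) (hx : x = (M * m * μ) ^ (-(n + 1))) :
    q ^ n / (m * τ)
        ≤ (M * μ / (q * τ)) * Real.exp (-2 * Real.sqrt (Real.log (1 / q) * Real.log (1 / x))) ∧
    (q < 1 → (n + 1) ^ 2 = Real.log (1 / x) / Real.log (1 / q) →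
      q ^ n / (m * τ)
        = (M * μ / (q * τ)) * Real.exp (-2 * Real.sqrt (Real.log (1 / q) * Real.log (1 / x)))) := by
  obtain ⟨hq0, hq1⟩ := hq
  have hL : 0 < Real.log (M * m * μ) := Real.log_pos hMmμ
  have hlogx : Real.log (1 / x) = (n + 1) * Real.log (M * m * μ) := by
    rw [hx, one_div, Real.log_inv, Real.log_rpow (by positivity)]
    ring
  have ha : 0 ≤ Real.log (1 / q) := Real.log_nonneg (one_le_one_div hq0 hq1)
  have hprod : Real.log (1 / q) * Real.log (1 / x)
      = ((n + 1) * Real.log (1 / q)) * Real.log (M * m * μ) := by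
    rw [hlogx]
    ring
  rw [rpow_div_eq_mul_exp n hτ hq0 hM hμ hm, hprod]
  refine ⟨?_, fun hlt heq => ?_⟩
  · have amgm := two_mul_sqrt_mul_le_add (mul_nonneg (by linarith : 0 ≤ n + 1) ha) hL.le
    gcongr
    linarith
  · have ha' : 0 < Real.log (1 / q) := Real.log_pos (one_lt_one_div hq0 hlt)
    have hbalance : (n + 1) * Real.log (1 / q) = Real.log (M * m * μ) := by
      rw [hlogx, eq_div_iff ha'.ne'] at heq
      apply mul_left_cancel₀ (by linarith : n + 1 ≠ 0)
      linarith
    rw [hbalance, Real.sqrt_mul_self hL.le]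
    ring_nf
end

section
/- Let α, L, τ > 0, μ > 0, q ∈ (0,1], M ≥ 1, and let λ_t ∈ (1/2, 1] with b = log₂ λ_t (so −1 < b ≤ 0). Set A = b·ln(Mμ) − ln(q(1−1/e)) and assume A > 0. Define n* = √((b+1)·αL/A) − 1 and m* = e^{αL/(n*+1)}/(Mμ). Then the lossy-switch lower-bound family member attains exactly the closed form: q^{n*} (1−1/e)^{n*+1} λ_t^{n*·log₂ m*} · (Mμ) · e^{−αL/(n*+1)} / τ = ((Mμ)^{b+1}/(qτ)) · exp( −c_exp·αL − 2·c_sub·√(αL) ), where c_exp = −log₂ λ_t and c_sub = √((b+1)·A) = [ b·ln((Mμ)^{1+b}/(q(1−1/e))) − ln(q(1−1/e)) ]^{1/2}. -/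
/-- closed form of the lossy-switch lower-bound family member at the
optimal operating point `n* = √((b+1)αL/A) − 1`, `m* = e^{αL/(n*+1)}/(Mμ)`, with
`b = log₂ λ_t`, `A = b ln(Mμ) − ln(q(1−1/e))`, `c_exp = −log₂ λ_t`,
`c_sub = √((b+1)A) = [b ln((Mμ)^{1+b}/(q(1−1/e))) − ln(q(1−1/e))]^{1/2}`. -/
theorem stmt8 (α L τ μ q M lt : ℝ) (hα : 0 < α) (hL : 0 < L) (hτ : 0 < τ) (hμ : 0 < μ)
    (hq : q ∈ Set.Ioc (0:ℝ) 1) (hM : 1 ≤ M) (hlt : lt ∈ Set.Ioc (1/2 : ℝ) 1)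
    (b A nstar mstar cexp csub : ℝ)
    (hb : b = Real.logb 2 lt)
    (hA : A = b * Real.log (M * μ) - Real.log (q * (1 - 1 / Real.exp 1)))
    (hApos : 0 < A)
    (hn : nstar = Real.sqrt ((b + 1) * (α * L) / A) - 1)
    (hm : mstar = Real.exp (α * L / (nstar + 1)) / (M * μ))
    (hce : cexp = -Real.logb 2 lt)
    (hcs : csub = Real.sqrt ((b + 1) * A)) :
    q ^ nstar * (1 - 1 / Real.exp 1) ^ (nstar + 1) * lt ^ (nstar * Real.logb 2 mstar)
          * (M * μ) * Real.exp (-(α * L) / (nstar + 1)) / τ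
        = ((M * μ) ^ (b + 1) / (q * τ)) *
            Real.exp (-cexp * (α * L) - 2 * csub * Real.sqrt (α * L)) ∧
    csub = Real.sqrt (b * Real.log ((M * μ) ^ (1 + b) / (q * (1 - 1 / Real.exp 1)))
            - Real.log (q * (1 - 1 / Real.exp 1))) := by
  obtain ⟨hq0, -⟩ := hq
  obtain ⟨hlt0, -⟩ := hlt
  have hltpos : 0 < lt := by linarith
  have hMμ : 0 < M * μ := by positivity
  have hx : 0 < α * L := by positivity
  have hb1 : 0 < b + 1 := by
    have h : Real.logb 2 (1 / 2) < Real.logb 2 lt :=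
      Real.logb_lt_logb (by norm_num) (by norm_num) hlt0
    have h2 : Real.logb 2 (1 / 2) = -1 := by
      rw [one_div, Real.logb_inv, Real.logb_self_eq_one (by norm_num)]
    linarith
  have hc : 0 < 1 - 1 / Real.exp 1 := by
    rw [sub_pos, div_lt_one (Real.exp_pos 1)]
    exact Real.one_lt_exp_iff.mpr one_pos
  generalize 1 - 1 / Real.exp 1 = c at *
  generalize α * L = x at *
  generalize M * μ = y at *
  have hlogqc : Real.log (q * c) = Real.log q + Real.log c :=
    Real.log_mul hq0.ne' hc.ne'
  constructor
  · have hS : 0 < √(b + 1) := Real.sqrt_pos.mpr hb1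
    have hT : 0 < √A := Real.sqrt_pos.mpr hApos
    have hR : 0 < √x := Real.sqrt_pos.mpr hx
    have hS2 := Real.sq_sqrt hb1.le
    have hT2 := Real.sq_sqrt hApos.le
    have hR2 := Real.sq_sqrt hx.le
    have hN : nstar + 1 = √(b + 1) * √x / √A := by
      rw [hn, Real.sqrt_div (by positivity), Real.sqrt_mul hb1.le]
      ring
    have hNpos : 0 < nstar + 1 := by rw [hN]; positivity
    have hcs' : csub = √(b + 1) * √A := by rw [hcs, Real.sqrt_mul hb1.le]
    have hNA : (nstar + 1) * A = csub * √x := by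
      rw [hN, hcs']
      field_simp
      linear_combination -hT2
    have hxN : (b + 1) * (x / (nstar + 1)) = csub * √x := by
      rw [hN, hcs']
      field_simp
      linear_combination x * hS2.symm + √(b + 1) ^ 2 * hR2.symm
    have hmlog : Real.log mstar = x / (nstar + 1) - Real.log y := by
      rw [hm, Real.log_div (Real.exp_pos _).ne' hMμ.ne', Real.log_exp]
    have hltexp : Real.log lt * (nstar * Real.logb 2 mstar)
        = b * (nstar * (x / (nstar + 1) - Real.log y)) := by
      rw [← hmlog, hb, Real.logb, Real.logb]
      ring
    have hcancel : x / (nstar + 1) * (nstar + 1) = x := div_mul_cancel₀ x hNpos.ne'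
    have hexpq : q = Real.exp (Real.log q) := (Real.exp_log hq0).symm
    have hexpy : y = Real.exp (Real.log y) := (Real.exp_log hMμ).symm
    have key : q ^ nstar * c ^ (nstar + 1) * lt ^ (nstar * Real.logb 2 mstar)
        * y * Real.exp (-x / (nstar + 1)) * q
        = y ^ (b + 1) * Real.exp (-cexp * x - 2 * csub * √x) := by
      rw [Real.rpow_def_of_pos hq0, Real.rpow_def_of_pos hc, Real.rpow_def_of_pos hltpos,
        Real.rpow_def_of_pos hMμ, hltexp]
      nth_rewrite 2 [hexpy]
      nth_rewrite 2 [hexpq]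
      simp only [← Real.exp_add]
      congr 1
      rw [hce, ← hb, neg_div]
      rw [hlogqc] at hA
      linear_combination (nstar + 1) * hA - hNA - hxN + b * hcancel
    rw [div_mul_eq_mul_div, ← key]
    field_simp
  · rw [hcs, Real.log_div (Real.rpow_pos_of_pos hMμ _).ne' (mul_pos hq0 hc).ne',
      Real.log_rpow hMμ, hA]
    congr 1
    ring
end

section
/- Let α, L, τ > 0, μ > 0, q ∈ (0,1], M ≥ 1, λ_t ∈ (1/2, 1] with b = log₂ λ_t, and suppose A = b·ln(Mμ) − ln(q(1−1/e)) > 0. For real w > 0 define F(w) = q^{w−1} (1−1/e)^{w} λ_t^{(w−1)·log₂ m(w)} · (Mμ) · e^{−αL/w} / τ where m(w) = e^{αL/w}/(Mμ). Then F is maximized over w ∈ (0,∞) at w* = √((b+1)·αL/A); i.e., F(w) ≤ F(w*) for all w > 0. Consequently the optimal (continuous) number of repeater stations is n*(L) = √((b+1)·αL/A) − 1 = √((log₂λ_t + 1)/(ln(Mμ)·log₂λ_t − ln(q(1−1/e))))·√(αL) − 1, and the optimal time-multiplexing block length is m*(L) = e^{αL/(n*(L)+1)}/(Mμ). -/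
theorem add_sq_div_le_add_sq_div {a v w : ℝ} (ha : 0 ≤ a) (hw : 0 < w) :
    a * v + a * v ^ 2 / v ≤ a * w + a * v ^ 2 / w := by
  have h : a * w + a * v ^ 2 / w - (a * v + a * v ^ 2 / v) = a * (w - v) ^ 2 / w := by
    field_simp
    ring
  have : 0 ≤ a * (w - v) ^ 2 / w := by positivity
  linarith

theorem neg_one_lt_logb_two {t : ℝ} (ht : 1 / 2 < t) : -1 < Real.logb 2 t := by
  rw [Real.lt_logb_iff_rpow_lt one_lt_two (by linarith), Real.rpow_neg_one]
  linarith

/-- The rate function in exponential form. -/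
theorem rate_eq_exp {x τ c q s t w : ℝ} (hτ : 0 < τ) (hc : 0 < c) (hq : 0 < q) (hs : 0 < s)
    (ht : 0 < t) (hw : 0 < w) :
    q ^ (w - 1) * s ^ w * t ^ ((w - 1) * Real.logb 2 (Real.exp (x / w) / c))
        * c * Real.exp (-x / w) / τ
      = Real.exp (-((Real.logb 2 t * Real.log c - Real.log (q * s)) * w
          + (Real.logb 2 t + 1) * x / w)
        + (Real.logb 2 t * x + Real.logb 2 t * Real.log c - Real.log q
          + (Real.log c - Real.log τ))) := by
  have hlog2 : Real.log 2 ≠ 0 := (Real.log_pos one_lt_two).ne'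
  conv_lhs =>
    rw [Real.rpow_def_of_pos hq, Real.rpow_def_of_pos hs, Real.rpow_def_of_pos ht]
  rw [Real.log_mul hq.ne' hs.ne', Real.logb, Real.logb, Real.log_div (Real.exp_ne_zero _) hc.ne',
    Real.log_exp]
  nth_rewrite 2 [← Real.exp_log hc]
  nth_rewrite 1 [← Real.exp_log hτ]
  rw [← Real.exp_add, ← Real.exp_add, ← Real.exp_add, ← Real.exp_add, ← Real.exp_sub]
  congr 1
  field_simp
  ring

/-- the lossy-switch lower-bound family member
`F(w) = q^{w−1} (1−1/e)^w λ_t^{(w−1)·log₂ m(w)} (Mμ) e^{−αL/w}/τ` with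
`m(w) = e^{αL/w}/(Mμ)` is maximized over `w > 0` at `w* = √((b+1)αL/A)`;
consequently the optimal (continuous) number of repeater stations satisfies
`n*(L) = √((b+1)αL/A) − 1 = √((log₂λ_t+1)/(ln(Mμ)log₂λ_t − ln(q(1−1/e))))·√(αL) − 1`. -/
theorem stmt9 (α L τ μ q M lt : ℝ) (hα : 0 < α) (hL : 0 < L) (hτ : 0 < τ) (hμ : 0 < μ)
    (hq : q ∈ Set.Ioc (0:ℝ) 1) (hM : 1 ≤ M) (hlt : lt ∈ Set.Ioc (1/2 : ℝ) 1)
    (b A : ℝ)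
    (hb : b = Real.logb 2 lt)
    (hA : A = b * Real.log (M * μ) - Real.log (q * (1 - 1 / Real.exp 1)))
    (hApos : 0 < A)
    (F : ℝ → ℝ)
    (hF : ∀ w : ℝ, F w = q ^ (w - 1) * (1 - 1 / Real.exp 1) ^ w
        * lt ^ ((w - 1) * Real.logb 2 (Real.exp (α * L / w) / (M * μ)))
        * (M * μ) * Real.exp (-(α * L) / w) / τ)
    (wstar : ℝ) (hw : wstar = Real.sqrt ((b + 1) * (α * L) / A)) :
    (∀ w : ℝ, 0 < w → F w ≤ F wstar) ∧
    wstar - 1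
      = Real.sqrt ((Real.logb 2 lt + 1) /
          (Real.log (M * μ) * Real.logb 2 lt - Real.log (q * (1 - 1 / Real.exp 1))))
        * Real.sqrt (α * L) - 1 := by
  have hq0 : 0 < q := hq.1
  have ht0 : 0 < lt := lt_trans (by norm_num) hlt.1
  have hs : 0 < 1 - 1 / Real.exp 1 := by
    rw [sub_pos, div_lt_one (Real.exp_pos 1)]
    exact Real.one_lt_exp_iff.2 one_pos
  have hc : 0 < M * μ := by positivity
  have hx : 0 < α * L := mul_pos hα hL
  have hb1 : 0 < b + 1 := by linarith [neg_one_lt_logb_two hlt.1]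
  have hw0 : 0 < wstar := by
    rw [hw]
    positivity
  have hw2 : A * wstar ^ 2 = (b + 1) * (α * L) := by
    rw [hw, Real.sq_sqrt (by positivity)]
    field_simp
  refine ⟨fun w hwpos => ?_, ?_⟩
  · rw [hF, hF, rate_eq_exp hτ hc hq0 hs ht0 hwpos, rate_eq_exp hτ hc hq0 hs ht0 hw0,
      ← hb, ← hA, ← hw2, Real.exp_le_exp]
    linarith [add_sq_div_le_add_sq_div (v := wstar) hApos.le hwpos]
  · rw [← hb, mul_comm (Real.log (M * μ)) b, ← hA, hw, ← Real.sqrt_mul (by positivity),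
      div_mul_eq_mul_div]
end

section
/- Let α, L, τ > 0, μ ∈ (0,1], q ∈ (0,1], M ≥ 1 an integer, λ_t ∈ (1/2, 1] with b = log₂ λ_t, and suppose A = b·ln(Mμ) − ln(q(1−1/e)) > 0. Let n* = √((b+1)·αL/A) − 1 and m* = e^{αL/(n*+1)}/(Mμ), and assume n* ≥ 0 and m* ≥ 1. Then the lossy-switch repeater rate with these (real) parameters satisfies (1 − (1 − μ e^{−αL/(n*+1)})^{M·m*})^{n*+1} · ( q·λ_t^{log₂ m*} )^{n*} / (m*·τ) ≥ ((Mμ)^{log₂λ_t + 1}/(qτ)) · exp( −c_exp·αL − 2·c_sub·√(αL) ), where c_exp = −log₂ λ_t and c_sub = [ log₂λ_t · ln((Mμ)^{1+log₂λ_t}/(q(1−1/e))) − ln(q(1−1/e)) ]^{1/2}. -/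
/-- If a trial succeeds with probability `1 / x`, then `x` trials contain a success with
probability at least `1 - 1 / e`. -/
theorem one_sub_inv_exp_one_le {x : ℝ} (hx : 1 ≤ x) :
    1 - 1 / Real.exp 1 ≤ 1 - (1 - 1 / x) ^ x := by
  have hx0 : 0 < x := by linarith
  have hle : 1 / x ≤ 1 := by rw [div_le_one hx0]; exact hx
  have h : (1 - 1 / x) ^ x ≤ Real.exp (-(1 / x)) ^ x :=
    Real.rpow_le_rpow (by linarith) (Real.one_sub_le_exp_neg _) hx0.le
  rw [← Real.exp_mul, neg_mul, one_div_mul_cancel hx0.ne', Real.exp_neg, inv_eq_one_div] at h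
  linarith

/-- The power `a ^ log₂ m` in exponential form, with the logarithm of base two taken of `a`. -/
theorem rpow_logb_eq_exp {a m : ℝ} (ha : 0 < a) :
    a ^ Real.logb 2 m = Real.exp (Real.logb 2 a * Real.log m) := by
  rw [Real.rpow_def_of_pos ha, Real.logb, Real.logb]
  congr 1
  ring

/-- the lossy-switch repeater rate at the (real-valued) optimal
parameters `n* = √((b+1)αL/A) − 1`, `m* = e^{αL/(n*+1)}/(Mμ)` is lower-bounded by
`((Mμ)^{log₂λ_t+1}/(qτ)) exp(−c_exp·αL − 2·c_sub·√(αL))`. -/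
theorem stmt10 (α L τ μ q lt : ℝ) (hα : 0 < α) (hL : 0 < L) (hτ : 0 < τ)
    (hμ : μ ∈ Set.Ioc (0:ℝ) 1) (hq : q ∈ Set.Ioc (0:ℝ) 1)
    (M : ℕ) (hM : 1 ≤ M) (hlt : lt ∈ Set.Ioc (1/2 : ℝ) 1)
    (b A nstar mstar cexp csub : ℝ)
    (hb : b = Real.logb 2 lt)
    (hA : A = b * Real.log ((M : ℝ) * μ) - Real.log (q * (1 - 1 / Real.exp 1)))
    (hApos : 0 < A)
    (hn : nstar = Real.sqrt ((b + 1) * (α * L) / A) - 1)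
    (hm : mstar = Real.exp (α * L / (nstar + 1)) / ((M : ℝ) * μ))
    (hnpos : 0 ≤ nstar) (hmpos : 1 ≤ mstar)
    (hce : cexp = -Real.logb 2 lt)
    (hcs : csub = Real.sqrt (Real.logb 2 lt
        * Real.log (((M : ℝ) * μ) ^ (1 + Real.logb 2 lt) / (q * (1 - 1 / Real.exp 1)))
        - Real.log (q * (1 - 1 / Real.exp 1)))) :
    (((M : ℝ) * μ) ^ (Real.logb 2 lt + 1) / (q * τ)) *
        Real.exp (-cexp * (α * L) - 2 * csub * Real.sqrt (α * L))
      ≤ (1 - (1 - μ * Real.exp (-(α * L) / (nstar + 1))) ^ ((M : ℝ) * mstar)) ^ (nstar + 1)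
          * (q * lt ^ Real.logb 2 mstar) ^ nstar / (mstar * τ) := by
  obtain ⟨hμ0, -⟩ := hμ
  obtain ⟨hq0, -⟩ := hq
  have hlt0 : 0 < lt := by linarith [hlt.1]
  have hM1 : (1 : ℝ) ≤ M := by exact_mod_cast hM
  have hM0 : (0 : ℝ) < M := by linarith
  have hK : 0 < (M : ℝ) * μ := mul_pos hM0 hμ0
  have hm0 : 0 < mstar := by linarith
  have hb1 : 0 < b + 1 := by
    have h : Real.logb 2 (1 / 2) < Real.logb 2 lt :=
      Real.logb_lt_logb (by norm_num) (by norm_num) hlt.1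
    rw [one_div, Real.logb_inv, Real.logb_self_eq_one (by norm_num)] at h
    linarith
  have ha : 0 < 1 - 1 / Real.exp 1 := by
    rw [sub_pos, div_lt_one (Real.exp_pos 1)]
    exact Real.one_lt_exp_iff.mpr one_pos
  rw [← hb] at hce hcs ⊢
  set x := α * L
  have hx0 : 0 < x := mul_pos hα hL
  obtain ⟨N, hN⟩ : ∃ N, N = nstar + 1 := ⟨_, rfl⟩
  have hN0 : 0 < N := by linarith
  have hn' : nstar = N - 1 := by linarith
  have hNs : N = Real.sqrt ((b + 1) * x / A) := by linarith
  rw [← hN] at hm ⊢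
  set a := 1 - 1 / Real.exp 1
  have hQ : Real.log (q * a) = Real.log q + Real.log a := Real.log_mul hq0.ne' ha.ne'
  have hlogm : Real.log mstar = x / N - Real.log (M * μ) := by
    rw [hm, Real.log_div (Real.exp_pos _).ne' hK.ne', Real.log_exp]
  have hNsq : N * A = (b + 1) * x / N := by
    have h : N ^ 2 = (b + 1) * x / A := by
      rw [hNs]; exact Real.sq_sqrt (by positivity)
    rw [eq_div_iff hApos.ne'] at h
    rw [eq_div_iff hN0.ne']
    linarith
  have hcx : csub * Real.sqrt x = N * A := by
    have h : b * Real.log ((M * μ) ^ (1 + b) / (q * a)) - Real.log (q * a) = (b + 1) * A := by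
      rw [Real.log_div (Real.rpow_pos_of_pos hK _).ne' (mul_pos hq0 ha).ne',
        Real.log_rpow hK, hA]
      ring
    rw [hcs, h, ← Real.sqrt_mul (by positivity),
      show (b + 1) * A * x = (b + 1) * x / A * A ^ 2 by field_simp,
      Real.sqrt_mul (by positivity), Real.sqrt_sq hApos.le, ← hNs]
  have hp : μ * Real.exp (-x / N) = 1 / (M * mstar) := by
    rw [hm, neg_div, Real.exp_neg]
    field_simp
  have hsucc : a ≤ 1 - (1 - μ * Real.exp (-x / N)) ^ ((M : ℝ) * mstar) := by
    rw [hp]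
    exact one_sub_inv_exp_one_le (by nlinarith)
  calc ((M : ℝ) * μ) ^ (b + 1) / (q * τ) * Real.exp (-cexp * x - 2 * csub * Real.sqrt x)
      = a ^ N * (q * lt ^ Real.logb 2 mstar) ^ nstar / (mstar * τ) := by
        have hr : q * lt ^ Real.logb 2 mstar = Real.exp (Real.log q + b * Real.log mstar) := by
          rw [rpow_logb_eq_exp hlt0, ← hb, Real.exp_add, Real.exp_log hq0]
        rw [hr, Real.rpow_def_of_pos hK, Real.rpow_def_of_pos ha, ← Real.exp_mul]
        rw [div_mul_eq_mul_div, div_eq_div_iff (by positivity) (by positivity)]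
        have hexp : Real.log (M * μ) * (b + 1) + (-cexp * x - 2 * csub * Real.sqrt x)
              + Real.log mstar
            = Real.log a * N + (Real.log q + b * Real.log mstar) * nstar + Real.log q := by
          have hxN : x = x / N * N := by field_simp
          rw [hlogm, hce, hn', mul_assoc 2, hcx]
          rw [mul_div_assoc] at hNsq
          rw [hQ] at hA
          linear_combination -hNsq - N * hA + b * hxN
        have h := congrArg Real.exp hexp
        simp only [Real.exp_add _ (Real.log _), Real.exp_log hm0, Real.exp_log hq0] at h
        rw [Real.exp_add, Real.exp_add] at h
        linear_combination τ * h
    _ ≤ _ := by gcongr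
end

section
/- Let α, τ, μ > 0, q ∈ (0,1], M ≥ 1, and let λ_t ∈ (1/2, 1] with b = log₂ λ_t, and suppose c_sub² = b·ln((Mμ)^{1+b}/(q(1−1/e))) − ln(q(1−1/e)) ≥ 0. Then, since c_exp = −b < 1, there exists L₀ > 0 such that for all L ≥ L₀: ((Mμ)^{1+b}/(qτ)) · exp( −c_exp·αL − 2·c_sub·√(αL) ) > (M/τ) · ( −log₂(1 − e^{−αL}) ). That is, when the per-switch loss satisfies λ_t > 1/2, the lossy-switch lower bound on the time-multiplexed repeater rate still eventually exceeds the repeaterless PLOB capacity. -/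
/-- For `x ≥ 1` the pure-loss capacity `−log₂(1 − e^{−x})` is at most `4 e^{−x}`. -/
theorem neg_logb_two_one_sub_exp_neg_le {x : ℝ} (hx : 1 ≤ x) :
    -Real.logb 2 (1 - Real.exp (-x)) ≤ 4 * Real.exp (-x) := by
  have hy0 : 0 < Real.exp (-x) := Real.exp_pos _
  have hy : Real.exp (-x) ≤ 1 / 2 := by
    rw [Real.exp_neg, ← one_div]
    exact one_div_le_one_div_of_le (by norm_num) (by linarith [Real.add_one_le_exp x])
  set y := Real.exp (-x)
  have hpos : 0 < 1 - y := by linarith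
  have hlog : -(2 * y) ≤ Real.log (1 - y) := by
    have h1 := Real.one_sub_inv_le_log_of_pos hpos
    have h2 : (1 - y)⁻¹ ≤ 1 + 2 * y := by
      rw [inv_le_iff_one_le_mul₀ hpos]
      nlinarith
    linarith
  have hl2 : 1 / 2 < Real.log 2 := by linarith [Real.log_two_gt_d9]
  rw [Real.logb, ← neg_div, div_le_iff₀ (by linarith)]
  nlinarith

/-- A linear term with positive slope eventually dominates a square-root term. -/
theorem exists_forall_ge_lt_mul_sub_mul_sqrt {a : ℝ} (ha : 0 < a) (c K : ℝ) :
    ∃ x₀ ≥ 1, ∀ x ≥ x₀, K < a * x - c * Real.sqrt x := by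
  set S := max 1 (max (K + 1) ((c + 1) / a))
  have hS1 : 1 ≤ S := le_max_left _ _
  have hSK : K + 1 ≤ S := (le_max_left _ _).trans (le_max_right _ _)
  have hSc : (c + 1) / a ≤ S := (le_max_right _ _).trans (le_max_right _ _)
  refine ⟨S ^ 2, by nlinarith, fun x hx => ?_⟩
  have hSs : S ≤ Real.sqrt x := Real.le_sqrt_of_sq_le hx
  have hsq : Real.sqrt x * Real.sqrt x = x := Real.mul_self_sqrt (by nlinarith)
  have hc : c + 1 ≤ Real.sqrt x * a := (div_le_iff₀ ha).mp (hSc.trans hSs)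
  calc K < Real.sqrt x * 1 := by linarith
    _ ≤ Real.sqrt x * (Real.sqrt x * a - c) := by
        gcongr
        linarith
    _ = a * (Real.sqrt x * Real.sqrt x) - c * Real.sqrt x := by ring
    _ = a * x - c * Real.sqrt x := by rw [hsq]

/-- with per-switch transmissivity `λ_t > 1/2` (so that
`c_exp = −log₂ λ_t < 1`) and `c_sub² = b ln((Mμ)^{1+b}/(q(1−1/e))) − ln(q(1−1/e)) ≥ 0`,
the lossy-switch lower bound `((Mμ)^{1+b}/(qτ)) exp(−c_exp·αL − 2 c_sub √(αL))`
eventually exceeds the repeaterless PLOB capacity `(M/τ)(−log₂(1 − e^{−αL}))`. -/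
theorem stmt16 (α τ μ q lt : ℝ) (hα : 0 < α) (hτ : 0 < τ) (hμ : 0 < μ)
    (hq : q ∈ Set.Ioc (0:ℝ) 1) (M : ℕ) (hM : 1 ≤ M)
    (hlt : lt ∈ Set.Ioc (1/2 : ℝ) 1) (b csub : ℝ)
    (hb : b = Real.logb 2 lt)
    (hcs2 : 0 ≤ b * Real.log (((M : ℝ) * μ) ^ (1 + b) / (q * (1 - 1 / Real.exp 1)))
        - Real.log (q * (1 - 1 / Real.exp 1)))
    (hcs : csub = Real.sqrt (b * Real.log (((M : ℝ) * μ) ^ (1 + b) / (q * (1 - 1 / Real.exp 1)))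
        - Real.log (q * (1 - 1 / Real.exp 1)))) :
    ∃ L₀ > 0, ∀ L ≥ L₀,
      (M : ℝ) / τ * (-Real.logb 2 (1 - Real.exp (-(α * L))))
        < (((M : ℝ) * μ) ^ (1 + b) / (q * τ)) *
            Real.exp (-(-b) * (α * L) - 2 * csub * Real.sqrt (α * L)) := by
  have hM0 : (0 : ℝ) < M := by exact_mod_cast hM
  have hq0 : 0 < q := hq.1
  have hb1 : 0 < 1 + b := by
    have h : Real.logb 2 (1 / 2) < Real.logb 2 lt :=
      Real.logb_lt_logb (by norm_num) (by norm_num) hlt.1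
    rw [one_div, Real.logb_inv, Real.logb_self_eq_one (by norm_num)] at h
    linarith
  have hC : 0 < ((M : ℝ) * μ) ^ (1 + b) / (q * τ) := by positivity
  set C := ((M : ℝ) * μ) ^ (1 + b) / (q * τ)
  obtain ⟨x₀, hx₀, h⟩ := exists_forall_ge_lt_mul_sub_mul_sqrt hb1 (2 * csub)
    (Real.log ((M : ℝ) / τ * 4 / C))
  refine ⟨x₀ / α, by positivity, fun L hL => ?_⟩
  have hx : x₀ ≤ α * L := by
    have := (div_le_iff₀ hα).mp hL
    linarith
  have hlt' := (Real.log_lt_iff_lt_exp (by positivity)).mp (h _ hx)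
  rw [div_lt_iff₀ hC] at hlt'
  calc (M : ℝ) / τ * (-Real.logb 2 (1 - Real.exp (-(α * L))))
      ≤ (M : ℝ) / τ * (4 * Real.exp (-(α * L))) := by
        gcongr
        exact neg_logb_two_one_sub_exp_neg_le (hx₀.trans hx)
    _ = (M : ℝ) / τ * 4 * Real.exp (-(α * L)) := by ring
    _ < Real.exp ((1 + b) * (α * L) - 2 * csub * Real.sqrt (α * L)) * C *
          Real.exp (-(α * L)) := by gcongr
    _ = C * (Real.exp ((1 + b) * (α * L) - 2 * csub * Real.sqrt (α * L)) *
          Real.exp (-(α * L))) := by ring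
    _ = C * Real.exp (-(-b) * (α * L) - 2 * csub * Real.sqrt (α * L)) := by
        rw [← Real.exp_add]
        ring_nf
end
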